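/- arXiv:1810.02961 — 2 statements merged into one kernel-verified Lean document; each statement's English description precedes it below -/
import Mathlib

section
/- Let A be a surjective d×n integer matrix and μ : ℂ^{2n} → ℂ^d the map μ(z,w) = Σ_{j=1}^n z_j w_j a_j, where a_j is the j-th column of A. Then for every ξ ∈ ℂ^d, the fiber μ^{-1}(ξ) has dimension 2n − d, i.e., it is a complete intersection in ℂ^{2n} cut out by d polynomial equations, each of whose irreducible components has dimension 2n − d. -/
open MvPolynomial

/-- The Krull dimension does not increase along an integral extension. -/
theorem ringKrullDim_le_of_ringHom_isIntegral {R S : Type*} [CommRing R] [CommRing S]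
    (f : R →+* S) (hf : f.IsIntegral) : ringKrullDim S ≤ ringKrullDim R := by
  algebraize [f]
  refine Order.krullDim_le_of_strictMono (PrimeSpectrum.comap (algebraMap R S)) fun p q hpq ↦ ?_
  exact Ideal.IsIntegral.comap_lt_comap (R := R) (I := p.asIdeal) (J := q.asIdeal) hpq

/-- The Krull dimension of a finitely generated domain over a field is at most its
transcendence degree. -/
theorem ringKrullDim_le_of_trdeg_le (k : Type*) {D : Type*} [Field k] [CommRing D] [IsDomain D]
    [Algebra k D] [Algebra.FiniteType k D] {m : ℕ} (h : Algebra.trdeg k D ≤ m) :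
    ringKrullDim D ≤ m := by
  obtain ⟨s, g, hg, hint⟩ := exists_integral_inj_algHom_of_fg k D
  have hle : s ≤ m := by
    have h1 := (lift_trdeg_le_of_injective g hg).trans (Cardinal.lift_le.2 h)
    rw [MvPolynomial.trdeg_of_isDomain] at h1
    simpa using h1
  refine (ringKrullDim_le_of_ringHom_isIntegral _ hint).trans ?_
  rw [MvPolynomial.ringKrullDim_of_isNoetherianRing, ringKrullDim_eq_zero_of_field]
  simpa using hle

/-- A domain generated by families `z` and `w`, all of whose products `z i * w i` lie in a subalgebra
generated by `k` elements, has transcendence degree at most `n + k`. -/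
theorem trdeg_le_of_mul_mem_adjoin {F D : Type*} [Field F] [CommRing D] [IsDomain D] [Algebra F D]
    {n k : ℕ} (z w : Fin n → D) (s : Fin k → D)
    (hgen : Algebra.adjoin F (Set.range z ∪ Set.range w) = ⊤)
    (hs : ∀ i, z i * w i ∈ Algebra.adjoin F (Set.range s)) :
    Algebra.trdeg F D ≤ (n + k : ℕ) := by
  classical
  let u : Fin n → D := fun i ↦ if z i = 0 then w i else z i
  let T : Set D := Set.range u ∪ Set.range s
  let B := Algebra.adjoin F T
  have hu (i) : u i ∈ B := Algebra.subset_adjoin (.inl ⟨i, rfl⟩)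
  have ht (i) : z i * w i ∈ B := Algebra.adjoin_mono Set.subset_union_right (hs i)
  have hB (x : D) (hx : x ∈ B) : IsAlgebraic B x := isAlgebraic_algebraMap (⟨x, hx⟩ : B)
  have hz (i) : z i ∈ B := by
    by_cases h : z i = 0
    · rw [h]; exact zero_mem _
    · simpa [u, h] using hu i
  have hw (i) : IsAlgebraic B (w i) := by
    by_cases h : z i = 0
    · exact hB _ (by simpa [u, h] using hu i)
    · refine ⟨Polynomial.C ⟨z i, hz i⟩ * Polynomial.X - Polynomial.C ⟨_, ht i⟩, fun h0 ↦ h ?_, ?_⟩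
      · simpa using congrArg (fun p ↦ ((p.coeff 1 : B) : D)) h0
      · simp
  have halg : Algebra.IsAlgebraic B D := by
    refine ⟨fun x ↦ ?_⟩
    have hx : x ∈ Algebra.adjoin F (Set.range z ∪ Set.range w) := hgen ▸ Algebra.mem_top
    induction hx using Algebra.adjoin_induction with
    | mem x hx =>
      rcases hx with ⟨i, rfl⟩ | ⟨i, rfl⟩
      · exact hB _ (hz i)
      · exact hw i
    | algebraMap r => exact hB _ (B.algebraMap_mem r)
    | add x y _ _ hx hy => exact hx.add hy
    | mul x y _ _ hx hy => exact hx.mul hy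
  refine (Algebra.IsAlgebraic.trdeg_le_cardinalMk F T).trans ((Cardinal.mk_union_le _ _).trans ?_)
  push_cast
  gcongr
  · simpa using Cardinal.mk_range_le_lift (f := u)
  · simpa using Cardinal.mk_range_le_lift (f := s)

/-- A solution in an `F`-algebra of a linear system with right-invertible `d × n` matrix lies in a
subalgebra generated by `n - d` elements. -/
theorem exists_mem_adjoin_of_linear_system {F D : Type*} [Field F] [CommRing D] [Algebra F D]
    {d n : ℕ} (A : Matrix (Fin d) (Fin n) F) (B : Matrix (Fin n) (Fin d) F) (hAB : A * B = 1)
    (t : Fin n → D) (ξ : Fin d → F) (ht : ∀ j, ∑ i, A j i • t i = algebraMap F D (ξ j)) :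
    ∃ k, k + d ≤ n ∧ ∃ s : Fin k → D, ∀ i, t i ∈ Algebra.adjoin F (Set.range s) := by
  classical
  let L : Submodule F D := F ∙ (1 : D)
  let φ : (Fin n → F) →ₗ[F] D ⧸ L := L.mkQ ∘ₗ Fintype.linearCombination F t
  have hinj : Function.Injective A.vecMulLinear := fun x y hxy ↦ by
    simpa [Matrix.vecMul_vecMul, hAB] using congrArg (Matrix.vecMul · B) hxy
  have hker : A.vecMulLinear.range ≤ φ.ker := by
    rintro _ ⟨y, rfl⟩
    have : Fintype.linearCombination F t (Matrix.vecMul y A) = algebraMap F D (∑ j, y j * ξ j) := by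
      simp only [Fintype.linearCombination_apply, Matrix.vecMul, dotProduct, map_sum, map_mul, ← ht,
        Finset.sum_smul, Finset.mul_sum]
      rw [Finset.sum_comm]
      simp [Algebra.smul_def, mul_assoc]
    simp only [LinearMap.mem_ker, φ, LinearMap.comp_apply, Matrix.vecMulLinear_apply, this]
    rw [Submodule.mkQ_apply, Submodule.Quotient.mk_eq_zero, Algebra.algebraMap_eq_smul_one]
    exact L.smul_mem _ (Submodule.mem_span_singleton_self 1)
  have hd : d ≤ Module.finrank F φ.ker := by
    simpa [LinearMap.finrank_range_of_inj hinj] using Submodule.finrank_mono hker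
  refine ⟨Module.finrank F φ.range, ?_, ?_⟩
  · have := φ.finrank_range_add_finrank_ker
    simp only [Module.finrank_fin_fun] at this
    omega
  let b := Module.finBasis F φ.range
  choose s hs using fun i ↦ L.mkQ_surjective (b i : D ⧸ L)
  refine ⟨s, fun i ↦ ?_⟩
  have hsum := b.sum_repr ⟨φ (Pi.single i 1), ⟨_, rfl⟩⟩
  set c := b.repr ⟨φ (Pi.single i 1), ⟨_, rfl⟩⟩
  have hmem : t i - ∑ j, c j • s j ∈ L := by
    rw [← Submodule.Quotient.mk_eq_zero, ← Submodule.mkQ_apply, map_sub, sub_eq_zero]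
    have h2 := congrArg Subtype.val hsum
    simp only [AddSubmonoidClass.coe_finsetSum, Submodule.coe_smul] at h2
    simp only [map_sum, map_smul, hs, h2]
    simp [φ, Fintype.linearCombination_apply, Pi.single_apply]
  obtain ⟨a, ha⟩ := Submodule.mem_span_singleton.1 hmem
  rw [← sub_add_cancel (t i) (∑ j, c j • s j), ← ha]
  exact add_mem (Subalgebra.smul_mem _ (one_mem _) _) (sum_mem fun j _ ↦
    Subalgebra.smul_mem _ (Algebra.subset_adjoin (Set.mem_range_self j)) _)

/-- All maximal ideals of a polynomial ring over an algebraically closed field have full height. -/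
theorem height_eq_card_of_isMaximal {K σ : Type*} [Field K] [IsAlgClosed K] [Finite σ]
    (m : Ideal (MvPolynomial σ K)) (hm : m.IsMaximal) : m.height = Nat.card σ := by
  have key (p q : Ideal (MvPolynomial σ K)) (hp : p.IsMaximal) (hq : q.IsMaximal) :
      p.height = q.height := by
    obtain ⟨x, rfl⟩ := eq_vanishingIdeal_singleton_of_isMaximal K hp
    obtain ⟨y, rfl⟩ := eq_vanishingIdeal_singleton_of_isMaximal K hq
    let e : MvPolynomial σ K ≃ₐ[K] MvPolynomial σ K := AlgEquiv.ofAlgHom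
      (aeval fun i ↦ X i + C (y i - x i)) (aeval fun i ↦ X i - C (y i - x i))
      (by ext; simp) (by ext; simp)
    have he : (vanishingIdeal K {x}).comap (e : MvPolynomial σ K →+* _) = vanishingIdeal K {y} := by
      ext f
      rw [Ideal.mem_comap, mem_vanishingIdeal_singleton_iff, mem_vanishingIdeal_singleton_iff]
      have : (aeval x).comp (e : MvPolynomial σ K →ₐ[K] _) = aeval (R := K) y := by
        ext i; simp [e]
      exact Eq.congr_left (DFunLike.congr_fun this f)
    rw [← he]
    exact (RingEquiv.height_comap e.toRingEquiv _).symm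
  have h := Ideal.sup_isMaximal_height_eq_ringKrullDim (R := MvPolynomial σ K)
  rw [MvPolynomial.ringKrullDim_of_isNoetherianRing, ringKrullDim_eq_zero_of_field, zero_add] at h
  have h2 : (⨆ (I : Ideal (MvPolynomial σ K)) (_ : I.IsMaximal), I.height) = m.height :=
    le_antisymm (iSup₂_le fun I hI ↦ (key I m hI hm).le) (le_iSup₂_of_le m hm le_rfl)
  rw [h2] at h
  exact_mod_cast h

/-- In a Noetherian Jacobson ring, every minimal prime `P` of an ideal is contained in a maximal
ideal that contains no other minimal prime of that ideal. -/
theorem exists_isMaximal_of_mem_minimalPrimes {R : Type*} [CommRing R] [IsNoetherianRing R]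
    [IsJacobsonRing R] {I P : Ideal R} (hP : P ∈ I.minimalPrimes) :
    ∃ m : Ideal R, m.IsMaximal ∧ P ≤ m ∧ ∀ Q ∈ I.minimalPrimes, Q ≤ m → Q = P := by
  classical
  have hPp : P.IsPrime := hP.isPrime
  have hfin := I.finite_minimalPrimes_of_isNoetherianRing
  let S := hfin.toFinset.erase P
  have hS : ¬ S.inf id ≤ P := by
    rw [hPp.inf_le']
    rintro ⟨Q, hQ, hQP⟩
    simp only [S, Finset.mem_erase, Set.Finite.mem_toFinset] at hQ
    exact hQ.1 (le_antisymm hQP (hP.2 hQ.2.1 hQP))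
  obtain ⟨f, hf, hfP⟩ := SetLike.not_le_iff_exists.1 hS
  rw [← hPp.radical, P.radical_eq_jacobson, Ideal.jacobson, Submodule.mem_sInf] at hfP
  push Not at hfP
  obtain ⟨m, ⟨hPm, hm⟩, hfm⟩ := hfP
  refine ⟨m, hm, hPm, fun Q hQ hQm ↦ by_contra fun hne ↦ hfm (hQm ?_)⟩
  exact (Finset.inf_le (f := id) (b := Q) (by simp [S, hne, hQ]) : S.inf id ≤ Q) hf

/-- The height of a maximal ideal modulo `I` is at most `dim R/P` if `P` is the only minimal prime
of `I` it contains. -/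
theorem height_map_quotient_le {R : Type*} [CommRing R] [IsNoetherianRing R]
    {I P m : Ideal R} [m.IsPrime] (hIm : I ≤ m)
    (h : ∀ Q ∈ I.minimalPrimes, Q ≤ m → Q = P) :
    ((m.map (Ideal.Quotient.mk I)).height : WithBot ℕ∞) ≤ ringKrullDim (R ⧸ P) := by
  have := Ideal.isPrime_map_quotientMk_of_isPrime hIm
  obtain ⟨l, hl, hlen⟩ := (m.map (Ideal.Quotient.mk I)).exists_ltSeries_length_eq_height
  rw [← hlen, ringKrullDim_quotient]
  let f := PrimeSpectrum.comap (Ideal.Quotient.mk I)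
  have hf : StrictMono f := RingHom.strictMono_comap_of_surjective Ideal.Quotient.mk_surjective
  have hmem (i) : f (l i) ∈ PrimeSpectrum.zeroLocus (P : Set R) := by
    have hI : I ≤ (f (l i)).asIdeal := fun x hx ↦ by
      simp [f, Ideal.Quotient.eq_zero_iff_mem.2 hx]
    obtain ⟨Q, hQ, hQl⟩ := Ideal.exists_minimalPrimes_le hI
    have hle : (f (l i)).asIdeal ≤ m := by
      have : (f (l i)).asIdeal ≤ (f l.last).asIdeal := hf.monotone (l.strictMono.monotone (Fin.le_last i))
      refine this.trans (le_of_eq ?_)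
      simp only [f, hl, PrimeSpectrum.comap_asIdeal]
      rw [Ideal.comap_map_quotientMk, sup_eq_right.2 hIm]
    exact h Q hQ (hQl.trans hle) ▸ hQl
  let l' : LTSeries (PrimeSpectrum.zeroLocus (P : Set R)) :=
    ⟨l.length, fun i ↦ ⟨f (l i), hmem i⟩, fun i ↦ hf (l.step i)⟩
  exact Order.LTSeries.length_le_krullDim l'

/-- For a surjective integer matrix `A`, every fiber `μ⁻¹(ξ)` of the moment map
`μ(z,w) = Σ z_j w_j a_j` is a complete intersection of dimension `2n - d`: every
irreducible component (minimal prime over the ideal of the `d` defining equations)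
has coordinate ring of Krull dimension `2n - d`. -/
theorem stmt_3 (d n : ℕ) (A : Matrix (Fin d) (Fin n) ℤ)
    (hA : Function.Surjective A.mulVec) (ξ : Fin d → ℂ) :
    ∀ P ∈ (Ideal.span (Set.range (fun j : Fin d =>
        ((∑ i : Fin n, C (A j i : ℂ) * X (Sum.inl i) * X (Sum.inr i)) - C (ξ j) :
          MvPolynomial (Fin n ⊕ Fin n) ℂ)))).minimalPrimes,
      ringKrullDim (MvPolynomial (Fin n ⊕ Fin n) ℂ ⧸ P) = ((2 * n - d : ℕ) : WithBot ℕ∞) := by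
  intro P hP
  have hPp : P.IsPrime := hP.isPrime
  set g : Fin d → MvPolynomial (Fin n ⊕ Fin n) ℂ := fun j ↦
    (∑ i : Fin n, C (A j i : ℂ) * X (Sum.inl i) * X (Sum.inr i)) - C (ξ j)
  obtain ⟨B, hB⟩ := Matrix.mulVec_surjective_iff_exists_right_inverse.1 hA
  let π := Ideal.Quotient.mkₐ ℂ P
  have hπ : Function.Surjective π := Ideal.Quotient.mkₐ_surjective ℂ P
  have hg (j) : π (g j) = 0 :=
    Ideal.Quotient.eq_zero_iff_mem.2 (hP.1.2 (Ideal.subset_span ⟨j, rfl⟩))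
  obtain ⟨k, hk, s, hs⟩ := exists_mem_adjoin_of_linear_system
    (A.map (Int.castRingHom ℂ)) (B.map (Int.castRingHom ℂ))
    (by rw [← Matrix.map_mul, hB, Matrix.map_one _ (map_zero _) (map_one _)])
    (fun i ↦ π (X (.inl i)) * π (X (.inr i))) ξ (fun j ↦ by
      have := hg j
      simp only [g, map_sub, map_sum, map_mul, sub_eq_zero] at this
      simpa [Algebra.smul_def, ← algebraMap_eq, mul_assoc] using this)
  apply le_antisymm
  · refine (ringKrullDim_le_of_trdeg_le ℂ (trdeg_le_of_mul_mem_adjoin _ _ s ?_ hs)).trans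
      (by norm_cast; omega)
    have := congrArg (Subalgebra.map π) (adjoin_range_X (R := ℂ) (σ := Fin n ⊕ Fin n))
    rw [Algebra.map_top, (AlgHom.range_eq_top _).2 hπ, AlgHom.map_adjoin] at this
    rw [← this, ← Set.range_comp, ← Set.Sum.elim_range]
    congr 2
    ext (i | i) <;> rfl
  · obtain ⟨m, hm, hPm, hmin⟩ := exists_isMaximal_of_mem_minimalPrimes hP
    have hIm := hP.1.2.trans hPm
    have hcard : (Set.range g).encard ≤ d := by
      rw [← Set.image_univ]
      simpa using Set.encard_image_le g Set.univ
    have hheight : ((2 * n - d : ℕ) : ℕ∞) ≤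
        (m.map (Ideal.Quotient.mk (Ideal.span (Set.range g)))).height := by
      rw [ENat.natCast_sub, tsub_le_iff_right]
      calc ((2 * n : ℕ) : ℕ∞) = m.height := by
            simp [height_eq_card_of_isMaximal m hm, two_mul]
        _ ≤ _ := Ideal.height_le_height_add_encard_of_subset (Set.range g) (Ideal.span_le.1 hIm)
        _ ≤ _ := by gcongr
    exact (WithBot.coe_le_coe.2 hheight).trans (height_map_quotient_le hIm hmin)
end

section
/- Let B be an n×3 unimodular integer matrix of rank 3 with no zero rows and no two rows equal up to sign. Then, up to elementary column operations over ℤ, row permutations, and row sign changes, B is equivalent to exactly one of five matrices: the one with rows {e_1,e_2,e_3}, {e_1,e_2,e_3,e_1+e_2}, {e_1,e_2,e_3,e_1+e_2+e_3}, {e_1,e_2,e_3,e_1+e_2,e_1+e_3}, or {e_1,e_2,e_3,e_1+e_2,e_1+e_3,e_1+e_2+e_3}. -/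
/-- `B` is equivalent to `T` via elementary column operations over `ℤ` (right
multiplication by a matrix of determinant `±1`), row permutations (a bijection of the
row indices), and row sign changes. -/
def RowColEquiv3 {n k : ℕ} (B : Matrix (Fin n) (Fin 3) ℤ) (T : Matrix (Fin k) (Fin 3) ℤ) : Prop :=
  ∃ (e : Fin n ≃ Fin k) (ε : Fin n → ℤ) (Q : Matrix (Fin 3) (Fin 3) ℤ),
    (∀ i, ε i = 1 ∨ ε i = -1) ∧ (Q.det = 1 ∨ Q.det = -1) ∧
    B = Matrix.diagonal ε * (T.submatrix e id) * Q

open Matrix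

/-- A matrix over `ℤ` of full column rank has a nonzero maximal minor. -/
theorem Matrix.exists_det_submatrix_ne_zero_of_rank_eq {n m : ℕ} (B : Matrix (Fin n) (Fin m) ℤ)
    (hrank : B.rank = m) :
    ∃ f : Fin m → Fin n, Function.Injective f ∧ (B.submatrix f id).det ≠ 0 := by
  set A : Matrix (Fin n) (Fin m) ℚ := B.map (Int.cast : ℤ → ℚ)
  have hcol : LinearIndependent ℤ B.col := by
    rw [linearIndependent_iff_card_eq_finrank_span, Set.finrank, ← rank_eq_finrank_span_cols,
      hrank, Fintype.card_fin]
  have hcolA : LinearIndependent ℚ A.col := by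
    rw [← LinearIndependent.iff_fractionRing (R := ℤ)]
    refine hcol.map_injOn ((Int.castAddHom ℚ).toIntLinearMap.compLeft (Fin n)) ?_
    intro x _ y _ hxy
    funext i
    simpa using congrFun hxy i
  have hrankA : Module.finrank ℚ (Submodule.span ℚ (Set.range A.row)) = m := by
    rw [← rank_eq_finrank_span_row, rank_eq_finrank_span_cols, finrank_span_eq_card hcolA,
      Fintype.card_fin]
  obtain ⟨κ, a, ha, hspan, hli⟩ := exists_linearIndependent' ℚ A.row
  have : Finite κ := Finite.of_injective a ha
  have := Fintype.ofFinite κ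
  have hcard : Fintype.card κ = m := by
    rw [← finrank_span_eq_card hli, hspan, hrankA]
  let e : Fin m ≃ κ := (Fintype.equivFinOfCardEq hcard).symm
  refine ⟨a ∘ e, ha.comp e.injective, fun hdet => ?_⟩
  have hli' : LinearIndependent ℚ (A.submatrix (a ∘ e) id).row := hli.comp e e.injective
  rw [linearIndependent_rows_iff_isUnit, isUnit_iff_isUnit_det, isUnit_iff_ne_zero] at hli'
  apply hli'
  have hcast := (Int.castRingHom ℚ).map_det (B.submatrix (a ∘ e) id)
  rw [hdet, map_zero] at hcast
  exact hcast.symm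

section SignedRows

variable {n : ℕ} {B : Matrix (Fin n) (Fin 3) ℤ}

/-- `x` is a row of `B` up to sign. -/
def SignedRow (B : Matrix (Fin n) (Fin 3) ℤ) (x : Fin 3 → ℤ) : Prop :=
  ∃ i, B i = x ∨ B i = -x

/-- Every determinant formed from three signed rows of `B` is `0` or `±1`. -/
def SignedUnimodular (B : Matrix (Fin n) (Fin 3) ℤ) : Prop :=
  ∀ x y z, SignedRow B x → SignedRow B y → SignedRow B z →
    (of ![x, y, z]).det ∈ ({0, 1, -1} : Set ℤ)

/-- `u, v, w` are signed rows of `B` forming a basis of `ℤ³`. -/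
structure IsFrame (B : Matrix (Fin n) (Fin 3) ℤ) (u v w : Fin 3 → ℤ) : Prop where
  fst : SignedRow B u
  snd : SignedRow B v
  trd : SignedRow B w
  det_eq : (of ![u, v, w]).det = 1 ∨ (of ![u, v, w]).det = -1

theorem signedRow_row (B : Matrix (Fin n) (Fin 3) ℤ) (i : Fin n) : SignedRow B (B i) :=
  ⟨i, Or.inl rfl⟩

theorem SignedRow.neg {x : Fin 3 → ℤ} (hx : SignedRow B x) : SignedRow B (-x) := by
  obtain ⟨i, h | h⟩ := hx
  · exact ⟨i, Or.inr (by simp [h])⟩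
  · exact ⟨i, Or.inl h⟩

theorem SignedRow.smul {x : Fin 3 → ℤ} (hx : SignedRow B x) {a : ℤ} (ha : a = 1 ∨ a = -1) :
    SignedRow B (a • x) := by
  rcases ha with rfl | rfl
  · simpa using hx
  · simpa using hx.neg

theorem det_of_vec (x y z : Fin 3 → ℤ) :
    (of ![x, y, z]).det = x 0 * y 1 * z 2 - x 0 * y 2 * z 1 - x 1 * y 0 * z 2 + x 1 * y 2 * z 0 +
      x 2 * y 0 * z 1 - x 2 * y 1 * z 0 := by
  simp [det_fin_three]

/-- Determinants of linear combinations of `u, v, w` factor through the coefficients. -/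
theorem det_of_comb (u v w a b c : Fin 3 → ℤ) :
    (of ![a 0 • u + a 1 • v + a 2 • w, b 0 • u + b 1 • v + b 2 • w,
      c 0 • u + c 1 • v + c 2 • w]).det = (of ![a, b, c]).det * (of ![u, v, w]).det := by
  simp only [det_of_vec, Pi.add_apply, Pi.smul_apply, smul_eq_mul]
  ring

theorem signedUnimodular_of_minors
    (hunim : ∀ f : Fin 3 → Fin n, Function.Injective f →
      (B.submatrix f id).det ∈ ({0, 1, -1} : Set ℤ)) : SignedUnimodular B := by
  have hrows : ∀ i j k, (of ![B i, B j, B k]).det ∈ ({0, 1, -1} : Set ℤ) := by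
    intro i j k
    by_cases h : Function.Injective ![i, j, k]
    · convert hunim _ h using 2
      ext a b
      fin_cases a <;> rfl
    · left
      obtain ⟨a, b, hab, hne⟩ := Function.not_injective_iff.mp h
      refine det_zero_of_row_eq hne ?_
      have hcomp : (of ![B i, B j, B k] : Matrix (Fin 3) (Fin 3) ℤ) =
          fun a => B (![i, j, k] a) := by
        ext a b
        fin_cases a <;> rfl
      rw [hcomp]
      exact congrArg B hab
  rintro x y z ⟨i, hi⟩ ⟨j, hj⟩ ⟨k, hk⟩
  have h := hrows i j k
  simp only [Set.mem_insert_iff, Set.mem_singleton_iff, det_of_vec] at h ⊢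
  rcases hi with hi | hi <;> rcases hj with hj | hj <;> rcases hk with hk | hk <;>
    simp only [hi, hj, hk, Pi.neg_apply] at h <;> grind

theorem exists_isFrame (hrank : B.rank = 3) (hB : SignedUnimodular B) :
    ∃ u v w, IsFrame B u v w := by
  obtain ⟨f, -, hf⟩ := B.exists_det_submatrix_ne_zero_of_rank_eq hrank
  have hdet : (of ![B (f 0), B (f 1), B (f 2)]).det ≠ 0 := by
    convert hf using 2
    ext a b
    fin_cases a <;> rfl
  refine ⟨_, _, _, signedRow_row B (f 0), signedRow_row B (f 1), signedRow_row B (f 2), ?_⟩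
  exact (hB _ _ _ (signedRow_row B (f 0)) (signedRow_row B (f 1))
    (signedRow_row B (f 2))).resolve_left hdet

theorem IsFrame.rotate {u v w : Fin 3 → ℤ} (h : IsFrame B u v w) : IsFrame B v w u := by
  refine ⟨h.snd, h.trd, h.fst, ?_⟩
  have := h.det_eq
  simp only [det_of_vec] at this ⊢
  grind

theorem IsFrame.swap {u v w : Fin 3 → ℤ} (h : IsFrame B u v w) : IsFrame B v u w := by
  refine ⟨h.snd, h.fst, h.trd, ?_⟩
  have := h.det_eq
  simp only [det_of_vec] at this ⊢
  grind

theorem IsFrame.smul {u v w : Fin 3 → ℤ} (h : IsFrame B u v w) {a b c : ℤ}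
    (ha : a = 1 ∨ a = -1) (hb : b = 1 ∨ b = -1) (hc : c = 1 ∨ c = -1) :
    IsFrame B (a • u) (b • v) (c • w) := by
  refine ⟨h.fst.smul ha, h.snd.smul hb, h.trd.smul hc, ?_⟩
  have := h.det_eq
  simp only [det_of_vec, Pi.smul_apply, smul_eq_mul] at this ⊢
  rcases ha with rfl | rfl <;> rcases hb with rfl | rfl <;> rcases hc with rfl | rfl <;> grind

/-- Determinants of coefficient vectors of signed rows in a frame are `0` or `±1`. -/
theorem IsFrame.det_coeff_mem {u v w : Fin 3 → ℤ} (h : IsFrame B u v w) (hB : SignedUnimodular B)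
    (a b c : Fin 3 → ℤ)
    (ha : SignedRow B (a 0 • u + a 1 • v + a 2 • w))
    (hb : SignedRow B (b 0 • u + b 1 • v + b 2 • w))
    (hc : SignedRow B (c 0 • u + c 1 • v + c 2 • w)) :
    (of ![a, b, c]).det = 0 ∨ (of ![a, b, c]).det = 1 ∨ (of ![a, b, c]).det = -1 := by
  have := hB _ _ _ ha hb hc
  rw [det_of_comb] at this
  simp only [Set.mem_insert_iff, Set.mem_singleton_iff] at this
  rcases h.det_eq with hq | hq <;> rw [hq] at this <;> omega

/-- In a frame, the signed rows have coefficients in `{0, 1, -1}`. -/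
theorem IsFrame.exists_coeff {u v w : Fin 3 → ℤ} (h : IsFrame B u v w) (hB : SignedUnimodular B)
    {x : Fin 3 → ℤ} (hx : SignedRow B x) :
    ∃ a b c : ℤ, (a = 0 ∨ a = 1 ∨ a = -1) ∧ (b = 0 ∨ b = 1 ∨ b = -1) ∧
      (c = 0 ∨ c = 1 ∨ c = -1) ∧ x = a • u + b • v + c • w := by
  have hcramer : (of ![u, v, w]).det • x = (of ![x, v, w]).det • u + (of ![u, x, w]).det • v +
      (of ![u, v, x]).det • w := by
    funext i
    simp only [det_of_vec, Pi.add_apply, Pi.smul_apply, smul_eq_mul]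
    fin_cases i <;> simp only [Fin.zero_eta, Fin.mk_one, Fin.reduceFinMk] <;> ring
  have h0 := hB _ _ _ hx h.snd h.trd
  have h1 := hB _ _ _ h.fst hx h.trd
  have h2 := hB _ _ _ h.fst h.snd hx
  simp only [Set.mem_insert_iff, Set.mem_singleton_iff] at h0 h1 h2
  rcases h.det_eq with hd | hd <;> rw [hd] at hcramer
  · exact ⟨_, _, _, h0, h1, h2, by simpa using hcramer⟩
  · refine ⟨-(of ![x, v, w]).det, -(of ![u, x, w]).det, -(of ![u, v, x]).det,
      by omega, by omega, by omega, ?_⟩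
    calc x = -((-1 : ℤ) • x) := by module
      _ = _ := by rw [hcramer]; module

/-- `B` is equivalent to `T` as soon as the signed rows of `B` are, up to sign, the rows of `T`
expressed in some frame. -/
theorem rowColEquiv3_of_isFrame {k : ℕ} {T : Matrix (Fin k) (Fin 3) ℤ} {u v w : Fin 3 → ℤ}
    (hns : ∀ i j : Fin n, i ≠ j → B i ≠ B j ∧ B i ≠ -B j)
    (hT : ∀ i j : Fin k, ∀ s ∈ ({1, -1} : Finset ℤ), (∀ l, T i l = s * T j l) → i = j)
    (h : IsFrame B u v w)
    (hmem : ∀ j, SignedRow B (T j 0 • u + T j 1 • v + T j 2 • w))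
    (hcover : ∀ x, SignedRow B x → ∃ j, x = T j 0 • u + T j 1 • v + T j 2 • w ∨
      x = -(T j 0 • u + T j 1 • v + T j 2 • w)) :
    RowColEquiv3 B T := by
  set Q : Matrix (Fin 3) (Fin 3) ℤ := of ![u, v, w] with hQ
  have hcomb : ∀ j, T j 0 • u + T j 1 • v + T j 2 • w = T j ᵥ* Q := by
    intro j
    funext i
    simp [hQ, vecMul, dotProduct, Fin.sum_univ_three]
  have hQunit : IsUnit Q := by
    rw [isUnit_iff_isUnit_det, Int.isUnit_iff]
    exact h.det_eq
  have hQinj : Function.Injective fun x : Fin 3 → ℤ => x ᵥ* Q := vecMul_injective_of_isUnit hQunit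
  simp only [hcomb] at hmem hcover
  choose g hg using fun i => hcover (B i) (signedRow_row B i)
  have hginj : Function.Injective g := by
    intro i j hij
    by_contra hne
    have := hns i j hne
    rcases hg i with hi | hi <;> rcases hg j with hj | hj <;> rw [hi, hj, hij] at this <;>
      simp at this
  have hgsurj : Function.Surjective g := by
    intro j
    obtain ⟨i, hi⟩ := hmem j
    refine ⟨i, ?_⟩
    have hor : T (g i) ᵥ* Q = T j ᵥ* Q ∨ T (g i) ᵥ* Q = (-T j) ᵥ* Q := by
      rw [neg_vecMul]
      rcases hg i with hi' | hi' <;> rcases hi with hi | hi <;> rw [hi'] at hi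
      · exact Or.inl hi
      · exact Or.inr hi
      · exact Or.inr (neg_eq_iff_eq_neg.mp hi)
      · exact Or.inl (neg_inj.mp hi)
    rcases hor with h' | h'
    · exact hT _ _ 1 (by simp) fun l => by simpa using congrFun (hQinj h') l
    · exact hT _ _ (-1) (by simp) fun l => by simpa using congrFun (hQinj h') l
  have hsign : ∀ i, ∃ s : ℤ, (s = 1 ∨ s = -1) ∧ B i = s • (T (g i) ᵥ* Q) := by
    intro i
    rcases hg i with hi | hi
    · exact ⟨1, Or.inl rfl, by simpa using hi⟩
    · exact ⟨-1, Or.inr rfl, by simpa using hi⟩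
  choose s hs hBs using hsign
  refine ⟨Equiv.ofBijective g ⟨hginj, hgsurj⟩, s, Q, hs, h.det_eq, ?_⟩
  ext i j
  rw [hBs i, Matrix.mul_assoc, diagonal_mul]
  rfl

end SignedRows

section Classification

variable {n : ℕ} {B : Matrix (Fin n) (Fin 3) ℤ} {u v w : Fin 3 → ℤ}

/-- In a frame `u, v, w` with `u + v + w` a signed row, all signed rows have, up to sign,
coefficients in `{0, 1}`. -/
theorem IsFrame.exists_of_circuit (h : IsFrame B u v w) (hB : SignedUnimodular B)
    (hnz : ∀ x, SignedRow B x → x ≠ 0)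
    (hs : SignedRow B (u + v + w)) {x : Fin 3 → ℤ} (hx : SignedRow B x) :
    ∃ y, SignedRow B y ∧ (x = y ∨ x = -y) ∧
      (y = u ∨ y = v ∨ y = w ∨ y = u + v + w ∨ y = u + v ∨ y = u + w ∨ y = v + w) := by
  suffices h' : ∃ y, (x = y ∨ x = -y) ∧
      (y = u ∨ y = v ∨ y = w ∨ y = u + v + w ∨ y = u + v ∨ y = u + w ∨ y = v + w) by
    obtain ⟨y, hxy, hy⟩ := h'
    refine ⟨y, ?_, hxy, hy⟩
    rcases hxy with rfl | rfl
    · exact hx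
    · simpa using hx.neg
  obtain ⟨a, b, c, ha, hb, hc, rfl⟩ := h.exists_coeff hB hx
  have hbc := h.det_coeff_mem hB ![1, 1, 1] ![a, b, c] ![1, 0, 0]
    (by simpa using hs) (by simpa using hx) (by simpa using h.fst)
  have hac := h.det_coeff_mem hB ![1, 1, 1] ![a, b, c] ![0, 1, 0]
    (by simpa using hs) (by simpa using hx) (by simpa using h.snd)
  have hab := h.det_coeff_mem hB ![1, 1, 1] ![a, b, c] ![0, 0, 1]
    (by simpa using hs) (by simpa using hx) (by simpa using h.trd)
  have hne := hnz _ hx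
  simp only [det_of_vec, cons_val_zero, cons_val_one, cons_val] at hbc hac hab
  simp only [and_or_left, exists_or, exists_eq_right]
  rcases ha with rfl | rfl | rfl <;> rcases hb with rfl | rfl | rfl <;>
    rcases hc with rfl | rfl | rfl <;> first
    | (exfalso; omega)
    | (exfalso; apply hne; simp; done)
    | grind

theorem rowColEquiv3_of_circuit (h : IsFrame B u v w) (hB : SignedUnimodular B)
    (hnz : ∀ x, SignedRow B x → x ≠ 0)
    (hns : ∀ i j : Fin n, i ≠ j → B i ≠ B j ∧ B i ≠ -B j)
    (hs : SignedRow B (u + v + w)) (huv : ¬SignedRow B (u + v)) (huw : ¬SignedRow B (u + w))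
    (hvw : ¬SignedRow B (v + w)) :
    RowColEquiv3 B !![1, 0, 0; 0, 1, 0; 0, 0, 1; 1, 1, 1] := by
  refine rowColEquiv3_of_isFrame hns (by decide) h ?_ fun x hx => ?_
  · intro j
    fin_cases j
    · simpa using h.fst
    · simpa using h.snd
    · simpa using h.trd
    · simpa using hs
  · obtain ⟨y, hy, hxy, rfl | rfl | rfl | rfl | rfl | rfl | rfl⟩ :=
      h.exists_of_circuit hB hnz hs hx
    · exact ⟨0, by simpa using hxy⟩
    · exact ⟨1, by simpa using hxy⟩
    · exact ⟨2, by simpa using hxy⟩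
    · exact ⟨3, by simpa using hxy⟩
    · exact absurd hy huv
    · exact absurd hy huw
    · exact absurd hy hvw

theorem rowColEquiv3_of_circuit_of_add (h : IsFrame B u v w) (hB : SignedUnimodular B)
    (hnz : ∀ x, SignedRow B x → x ≠ 0)
    (hns : ∀ i j : Fin n, i ≠ j → B i ≠ B j ∧ B i ≠ -B j)
    (hs : SignedRow B (u + v + w)) (huv : SignedRow B (u + v)) (huw : ¬SignedRow B (u + w))
    (hvw : ¬SignedRow B (v + w)) :
    RowColEquiv3 B !![1, 0, 0; 0, 1, 0; 0, 0, 1; 1, 1, 0; 1, 0, 1] := by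
  have hframe : IsFrame B (u + v) (-u) w := by
    refine ⟨huv, h.fst.neg, h.trd, ?_⟩
    have := h.det_eq
    simp only [det_of_vec, Pi.add_apply, Pi.neg_apply] at this ⊢
    grind
  refine rowColEquiv3_of_isFrame hns (by decide) hframe ?_ fun x hx => ?_
  · intro j
    fin_cases j
    · simpa using huv
    · simpa using h.fst.neg
    · simpa using h.trd
    · simpa using h.snd
    · simpa using hs
  · obtain ⟨y, hy, hxy, rfl | rfl | rfl | rfl | rfl | rfl | rfl⟩ :=
      h.exists_of_circuit hB hnz hs hx
    · exact ⟨1, by simpa using hxy.symm⟩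
    · exact ⟨3, by simpa using hxy⟩
    · exact ⟨2, by simpa using hxy⟩
    · exact ⟨4, by simpa using hxy⟩
    · exact ⟨0, by simpa using hxy⟩
    · exact absurd hy huw
    · exact absurd hy hvw

theorem rowColEquiv3_of_circuit_of_add_of_add (h : IsFrame B u v w) (hB : SignedUnimodular B)
    (hnz : ∀ x, SignedRow B x → x ≠ 0)
    (hns : ∀ i j : Fin n, i ≠ j → B i ≠ B j ∧ B i ≠ -B j)
    (hs : SignedRow B (u + v + w)) (huv : SignedRow B (u + v)) (huw : SignedRow B (u + w))
    (hvw : ¬SignedRow B (v + w)) :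
    RowColEquiv3 B !![1, 0, 0; 0, 1, 0; 0, 0, 1; 1, 1, 0; 1, 0, 1; 1, 1, 1] := by
  refine rowColEquiv3_of_isFrame hns (by decide) h ?_ fun x hx => ?_
  · intro j
    fin_cases j
    · simpa using h.fst
    · simpa using h.snd
    · simpa using h.trd
    · simpa using huv
    · simpa using huw
    · simpa using hs
  · obtain ⟨y, hy, hxy, rfl | rfl | rfl | rfl | rfl | rfl | rfl⟩ :=
      h.exists_of_circuit hB hnz hs hx
    · exact ⟨0, by simpa using hxy⟩
    · exact ⟨1, by simpa using hxy⟩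
    · exact ⟨2, by simpa using hxy⟩
    · exact ⟨5, by simpa using hxy⟩
    · exact ⟨3, by simpa using hxy⟩
    · exact ⟨4, by simpa using hxy⟩
    · exact absurd hy hvw

theorem IsFrame.not_signedRow_add (h : IsFrame B u v w) (hB : SignedUnimodular B)
    (huv : SignedRow B (u + v)) (huw : SignedRow B (u + w)) : ¬SignedRow B (v + w) := by
  intro hvw
  have := h.det_coeff_mem hB ![1, 1, 0] ![1, 0, 1] ![0, 1, 1]
    (by simpa using huv) (by simpa using huw) (by simpa using hvw)
  simp [det_of_vec] at this

theorem rowColEquiv3_or_of_circuit (h : IsFrame B u v w) (hB : SignedUnimodular B)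
    (hnz : ∀ x, SignedRow B x → x ≠ 0)
    (hns : ∀ i j : Fin n, i ≠ j → B i ≠ B j ∧ B i ≠ -B j)
    (hs : SignedRow B (u + v + w)) :
    RowColEquiv3 B !![1, 0, 0; 0, 1, 0; 0, 0, 1; 1, 1, 1] ∨
      RowColEquiv3 B !![1, 0, 0; 0, 1, 0; 0, 0, 1; 1, 1, 0; 1, 0, 1] ∨
      RowColEquiv3 B !![1, 0, 0; 0, 1, 0; 0, 0, 1; 1, 1, 0; 1, 0, 1; 1, 1, 1] := by
  have hs₁ : SignedRow B (v + w + u) := by rwa [add_comm, ← add_assoc]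
  have hs₂ : SignedRow B (w + u + v) := by rwa [add_assoc, add_comm]
  have h₁ := h.rotate
  have h₂ := h.rotate.rotate
  by_cases huv : SignedRow B (u + v) <;> by_cases huw : SignedRow B (u + w) <;>
    by_cases hvw : SignedRow B (v + w)
  · exact absurd hvw (h.not_signedRow_add hB huv huw)
  · exact .inr (.inr (rowColEquiv3_of_circuit_of_add_of_add h hB hnz hns hs huv huw hvw))
  · rw [add_comm] at huv huw
    exact .inr (.inr (rowColEquiv3_of_circuit_of_add_of_add h₁ hB hnz hns hs₁ hvw huv huw))
  · exact .inr (.inl (rowColEquiv3_of_circuit_of_add h hB hnz hns hs huv huw hvw))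
  · rw [add_comm] at huw hvw
    exact .inr (.inr (rowColEquiv3_of_circuit_of_add_of_add h₂ hB hnz hns hs₂ huw hvw huv))
  · rw [add_comm] at huw hvw
    exact .inr (.inl (rowColEquiv3_of_circuit_of_add h₂ hB hnz hns hs₂ huw hvw huv))
  · rw [add_comm] at huv huw
    exact .inr (.inl (rowColEquiv3_of_circuit_of_add h₁ hB hnz hns hs₁ hvw huv huw))
  · exact .inl (rowColEquiv3_of_circuit h hB hnz hns hs huv huw hvw)

/-- If no frame extends to a four-element circuit, a signed row `u + v` leaves no room for further
rows. -/
theorem rowColEquiv3_of_add (h : IsFrame B u v w) (hB : SignedUnimodular B)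
    (hnz : ∀ x, SignedRow B x → x ≠ 0)
    (hns : ∀ i j : Fin n, i ≠ j → B i ≠ B j ∧ B i ≠ -B j)
    (hcirc : ∀ u v w, IsFrame B u v w → ¬SignedRow B (u + v + w))
    (huv : SignedRow B (u + v)) :
    RowColEquiv3 B !![1, 0, 0; 0, 1, 0; 0, 0, 1; 1, 1, 0] := by
  have hnot : ∀ {u v w : Fin 3 → ℤ}, IsFrame B u v w → SignedRow B (u + v) → ∀ {a c : ℤ},
      (a = 1 ∨ a = -1) → (c = 1 ∨ c = -1) → ¬SignedRow B (a • u + c • w) := by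
    intro u v w h huv a c ha hc hac
    have hframe : IsFrame B (a • (u + v)) (c • w) (-(a • v)) := by
      refine ⟨huv.smul ha, h.trd.smul hc, (h.snd.smul ha).neg, ?_⟩
      have := h.det_eq
      simp only [det_of_vec, Pi.add_apply, Pi.neg_apply, Pi.smul_apply, smul_eq_mul] at this ⊢
      rcases ha with rfl | rfl <;> rcases hc with rfl | rfl <;> grind
    refine hcirc _ _ _ hframe ?_
    convert hac using 1
    module
  refine rowColEquiv3_of_isFrame hns (by decide) h ?_ fun x hx => ?_
  · intro j
    fin_cases j
    · simpa using h.fst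
    · simpa using h.snd
    · simpa using h.trd
    · simpa using huv
  · obtain ⟨a, b, c, ha, hb, hc, rfl⟩ := h.exists_coeff hB hx
    have hab := h.det_coeff_mem hB ![1, 1, 0] ![a, b, c] ![0, 0, 1]
      (by simpa using huv) (by simpa using hx) (by simpa using h.trd)
    simp only [det_of_vec, cons_val_zero, cons_val_one, cons_val] at hab
    rcases eq_or_ne c 0 with rfl | hc0
    · rcases ha with rfl | rfl | rfl <;> rcases hb with rfl | rfl | rfl
      · exact absurd (by simp) (hnz _ hx)
      · exact ⟨1, by simp⟩
      · exact ⟨1, by simp⟩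
      · exact ⟨0, by simp⟩
      · exact ⟨3, by simp⟩
      · omega
      · exact ⟨0, by simp⟩
      · omega
      · exact ⟨3, by right; simp; abel⟩
    · have hc1 := hc.resolve_left hc0
      rcases eq_or_ne a 0 with rfl | ha0 <;> rcases eq_or_ne b 0 with rfl | hb0
      · rcases hc1 with rfl | rfl <;> exact ⟨2, by simp⟩
      · exact absurd (by simpa using hx)
          (hnot h.swap (by rwa [add_comm]) (hb.resolve_left hb0) hc1)
      · exact absurd (by simpa using hx) (hnot h huv (ha.resolve_left ha0) hc1)
      · exact absurd hx
          (hcirc _ _ _ (h.smul (ha.resolve_left ha0) (hb.resolve_left hb0) hc1))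

/-- If no two members of a frame sum to a signed row, and no frame extends to a four-element
circuit, then `B` consists of a single frame. -/
theorem rowColEquiv3_one (h : IsFrame B u v w) (hB : SignedUnimodular B)
    (hnz : ∀ x, SignedRow B x → x ≠ 0)
    (hns : ∀ i j : Fin n, i ≠ j → B i ≠ B j ∧ B i ≠ -B j)
    (hcirc : ∀ u v w, IsFrame B u v w → ¬SignedRow B (u + v + w))
    (hadd : ∀ u v w, IsFrame B u v w → ¬SignedRow B (u + v)) :
    RowColEquiv3 B (1 : Matrix (Fin 3) (Fin 3) ℤ) := by
  refine rowColEquiv3_of_isFrame hns (by decide) h ?_ fun x hx => ?_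
  · intro j
    fin_cases j
    · simpa [Matrix.one_apply] using h.fst
    · simpa [Matrix.one_apply] using h.snd
    · simpa [Matrix.one_apply] using h.trd
  · obtain ⟨a, b, c, ha, hb, hc, rfl⟩ := h.exists_coeff hB hx
    rcases ha with rfl | ha <;> rcases hb with rfl | hb <;> rcases hc with rfl | hc
    · exact absurd (by simp) (hnz _ hx)
    · rcases hc with rfl | rfl <;> exact ⟨2, by simp⟩
    · rcases hb with rfl | rfl <;> exact ⟨1, by simp⟩
    · exact absurd (by simpa using hx) (hadd _ _ _ (h.rotate.smul hb hc (Or.inl rfl)))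
    · rcases ha with rfl | rfl <;> exact ⟨0, by simp⟩
    · exact absurd (by simpa [add_comm] using hx)
        (hadd _ _ _ (h.rotate.rotate.smul hc ha (Or.inl rfl)))
    · exact absurd (by simpa using hx) (hadd _ _ _ (h.smul ha hb (Or.inl rfl)))
    · exact absurd hx (hcirc _ _ _ (h.smul ha hb hc))

end Classification

section Uniqueness

variable {n k : ℕ} {B : Matrix (Fin n) (Fin 3) ℤ} {T : Matrix (Fin k) (Fin 3) ℤ}

theorem RowColEquiv3.card_eq (h : RowColEquiv3 B T) : n = k := by
  obtain ⟨e, -⟩ := h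
  simpa using Fintype.card_congr e

/-- Equivalent matrices have the same vanishing maximal minors. -/
theorem RowColEquiv3.exists_det_eq_zero_iff (h : RowColEquiv3 B T) :
    ∃ e : Fin n ≃ Fin k, ∀ f : Fin 3 → Fin n,
      (B.submatrix f id).det = 0 ↔ (T.submatrix (e ∘ f) id).det = 0 := by
  obtain ⟨e, s, Q, hs, hQ, rfl⟩ := h
  refine ⟨e, fun f => ?_⟩
  have hfac : (diagonal s * T.submatrix e id * Q).submatrix f id =
      diagonal (s ∘ f) * T.submatrix (e ∘ f) id * Q := by
    ext i j
    rw [Matrix.mul_assoc, Matrix.mul_assoc, submatrix_apply, diagonal_mul, diagonal_mul]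
    rfl
  have hs0 : ∏ i, (s ∘ f) i ≠ 0 := by
    refine Finset.prod_ne_zero_iff.mpr fun i _ => ?_
    rcases hs (f i) with h | h <;> simp [h]
  have hQ0 : Q.det ≠ 0 := by
    rcases hQ with h | h <;> simp [h]
  rw [hfac, det_mul, det_mul, det_diagonal]
  simp only [mul_eq_zero, hs0, hQ0, false_or, or_false]

theorem not_rowColEquiv3_add_and_circuit
    (h₁ : RowColEquiv3 B !![1, 0, 0; 0, 1, 0; 0, 0, 1; 1, 1, 0])
    (h₂ : RowColEquiv3 B !![1, 0, 0; 0, 1, 0; 0, 0, 1; 1, 1, 1]) : False := by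
  obtain ⟨e₁, he₁⟩ := h₁.exists_det_eq_zero_iff
  obtain ⟨e₂, he₂⟩ := h₂.exists_det_eq_zero_iff
  have hzero : (B.submatrix (e₁.symm ∘ ![0, 1, 3]) id).det = 0 := by
    rw [he₁, ← Function.comp_assoc, Equiv.self_comp_symm, Function.id_comp]
    decide
  rw [he₂] at hzero
  have hne : ∀ g : Fin 3 → Fin 4, Function.Injective g →
      ((!![1, 0, 0; 0, 1, 0; 0, 0, 1; 1, 1, 1] : Matrix (Fin 4) (Fin 3) ℤ).submatrix g id).det ≠
        0 := by
    simp only [det_fin_three]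
    decide
  exact hne _ (e₂.injective.comp (e₁.symm.injective.comp (by decide))) hzero

end Uniqueness

/-- Classification of rank-3 unimodular integer matrices with three columns, no zero rows
and no two rows equal up to sign: up to column operations over `ℤ`, row permutations and
row sign changes, `B` is exactly one of five matrices, with row sets
`{e₁,e₂,e₃}`, `{e₁,e₂,e₃,e₁+e₂}`, `{e₁,e₂,e₃,e₁+e₂+e₃}`, `{e₁,e₂,e₃,e₁+e₂,e₁+e₃}`,
`{e₁,e₂,e₃,e₁+e₂,e₁+e₃,e₁+e₂+e₃}`. -/
theorem stmt_14 (n : ℕ) (B : Matrix (Fin n) (Fin 3) ℤ)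
    (hrank : B.rank = 3)
    (hunim : ∀ f : Fin 3 → Fin n, Function.Injective f →
      (B.submatrix f id).det ∈ ({0, 1, -1} : Set ℤ))
    (hnz : ∀ i, (fun j => B i j) ≠ 0)
    (hns : ∀ i j : Fin n, i ≠ j →
      (fun k => B i k) ≠ (fun k => B j k) ∧ (fun k => B i k) ≠ (fun k => -B j k)) :
    ∃! c : Fin 5,
      if c = 0 then RowColEquiv3 B (1 : Matrix (Fin 3) (Fin 3) ℤ)
      else if c = 1 then
        RowColEquiv3 B (!![1, 0, 0; 0, 1, 0; 0, 0, 1; 1, 1, 0] : Matrix (Fin 4) (Fin 3) ℤ)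
      else if c = 2 then
        RowColEquiv3 B (!![1, 0, 0; 0, 1, 0; 0, 0, 1; 1, 1, 1] : Matrix (Fin 4) (Fin 3) ℤ)
      else if c = 3 then
        RowColEquiv3 B
          (!![1, 0, 0; 0, 1, 0; 0, 0, 1; 1, 1, 0; 1, 0, 1] : Matrix (Fin 5) (Fin 3) ℤ)
      else
        RowColEquiv3 B
          (!![1, 0, 0; 0, 1, 0; 0, 0, 1; 1, 1, 0; 1, 0, 1; 1, 1, 1] :
            Matrix (Fin 6) (Fin 3) ℤ) := by
  have hB := signedUnimodular_of_minors hunim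
  have hns' : ∀ i j : Fin n, i ≠ j → B i ≠ B j ∧ B i ≠ -B j := hns
  have hnz' : ∀ x, SignedRow B x → x ≠ 0 := by
    rintro _ ⟨i, hi⟩ rfl
    exact hnz i (by simpa using hi)
  obtain ⟨u, v, w, h⟩ := exists_isFrame hrank hB
  refine existsUnique_of_exists_of_unique ?_ ?_
  · by_cases hcirc : ∃ u v w, IsFrame B u v w ∧ SignedRow B (u + v + w)
    · obtain ⟨u, v, w, h, hs⟩ := hcirc
      rcases rowColEquiv3_or_of_circuit h hB hnz' hns' hs with hT | hT | hT
      · exact ⟨2, by simpa using hT⟩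
      · exact ⟨3, by simpa using hT⟩
      · exact ⟨4, by simpa using hT⟩
    · have hcirc' : ∀ u v w, IsFrame B u v w → ¬SignedRow B (u + v + w) :=
        fun u v w h hs => hcirc ⟨u, v, w, h, hs⟩
      by_cases hadd : ∃ u v w, IsFrame B u v w ∧ SignedRow B (u + v)
      · obtain ⟨u, v, w, h, huv⟩ := hadd
        exact ⟨1, by simpa using rowColEquiv3_of_add h hB hnz' hns' hcirc' huv⟩
      · have hT := rowColEquiv3_one h hB hnz' hns' hcirc'
          fun u v w h huv => hadd ⟨u, v, w, h, huv⟩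
        exact ⟨0, by simpa using hT⟩
  · intro c d hc hd
    fin_cases c <;> fin_cases d <;> first
      | rfl
      | (exfalso
         simp only [Fin.isValue, Fin.reduceFinMk, Fin.zero_eta, Fin.mk_one, Fin.reduceEq,
           one_ne_zero, if_true, if_false] at hc hd
         have hnc := hc.card_eq
         have hnd := hd.card_eq
         first
           | omega
           | exact not_rowColEquiv3_add_and_circuit hc hd
           | exact not_rowColEquiv3_add_and_circuit hd hc)
end
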